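/- arXiv:2207.00546 — 3 statements merged into one kernel-verified Lean document; each statement's English description precedes it below -/
import Mathlib

section
/- Let N ≥ 1, let 0 < C_inf ≤ C_sup, and let S be an N×N real symmetric matrix with Σ_{i=1}^N S_{ij} = 1 for every j and C_inf ≤ N·S_{ij} ≤ C_sup for all i,j. Let Π be the N×N matrix with all entries equal to 1/N and set T := S − Π. Then there exists a constant c₀ with C_inf ≤ c₀ ≤ 1 such that for every k ≥ 1, max_{a,b} |(T^k)_{ab}| ≤ ‖T^k‖ ≤ (1 − c₀)^k, where ‖·‖ denotes the operator norm on matrices induced by the Euclidean vector norm (the largest singular value). -/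
/-- The operator norm (largest singular value) of a real square matrix, i.e. the norm of the
induced continuous linear endomorphism of Euclidean space. -/
noncomputable def matrixOpNorm {N : ℕ} (A : Matrix (Fin N) (Fin N) ℝ) : ℝ :=
  ‖(Matrix.toEuclideanCLM (𝕜 := ℝ) A : EuclideanSpace ℝ (Fin N) →L[ℝ] EuclideanSpace ℝ (Fin N))‖

open Finset in
/-- A special case of the Schur test: a nonnegative matrix with all row and column sums equal to
`r` is bounded by `r` in the Euclidean norm. -/
theorem sum_sq_mulVec_le_of_sum_eq {ι : Type*} [Fintype ι] (R : Matrix ι ι ℝ) (r : ℝ)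
    (hR : ∀ i j, 0 ≤ R i j) (hrow : ∀ i, ∑ j, R i j = r) (hcol : ∀ j, ∑ i, R i j = r)
    (w : ι → ℝ) : ∑ i, (∑ j, R i j * w j) ^ 2 ≤ r ^ 2 * ∑ j, w j ^ 2 := by
  have h (i : ι) : (∑ j, R i j * w j) ^ 2 ≤ r * ∑ j, R i j * w j ^ 2 := by
    rw [← hrow i]
    refine sum_sq_le_sum_mul_sum_of_sq_le_mul _ (fun j _ => hR i j)
      (fun j _ => mul_nonneg (hR i j) (sq_nonneg _)) (fun j _ => le_of_eq (by ring))
  calc ∑ i, (∑ j, R i j * w j) ^ 2 ≤ ∑ i, r * ∑ j, R i j * w j ^ 2 := sum_le_sum fun i _ => h i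
    _ = r ^ 2 * ∑ j, w j ^ 2 := by
      rw [← mul_sum, sum_comm]
      simp_rw [← sum_mul, hcol]
      rw [← mul_sum]
      ring

/-- Subtracting the mean does not increase the sum of squares. -/
theorem sum_sq_sub_mean_le {ι : Type*} [Fintype ι] (v : ι → ℝ) :
    ∑ i, (v i - (∑ j, v j) / Fintype.card ι) ^ 2 ≤ ∑ i, v i ^ 2 := by
  rcases isEmpty_or_nonempty ι with h | h
  · simp
  have hc : (0 : ℝ) < Fintype.card ι := by exact_mod_cast Fintype.card_pos
  set m := (∑ j, v j) / (Fintype.card ι : ℝ) with hm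
  have hs : ∑ j, v j = Fintype.card ι * m := by rw [hm]; field_simp
  have : ∑ i, (v i - m) ^ 2 = ∑ i, v i ^ 2 - Fintype.card ι * m ^ 2 := by
    simp_rw [sub_sq, Finset.sum_add_distrib, Finset.sum_sub_distrib, ← Finset.sum_mul,
      ← Finset.mul_sum, hs]
    simp
    ring
  rw [this]
  have := mul_nonneg hc.le (sq_nonneg m)
  linarith

theorem abs_apply_le_matrixOpNorm {N : ℕ} (A : Matrix (Fin N) (Fin N) ℝ) (a b : Fin N) :
    |A a b| ≤ matrixOpNorm A := by
  have h := (Matrix.toEuclideanCLM (𝕜 := ℝ) A).le_opNorm (EuclideanSpace.single b 1)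
  rw [PiLp.norm_single, norm_one, mul_one] at h
  refine le_trans ?_ h
  refine le_trans (le_of_eq ?_)
    (PiLp.norm_apply_le (Matrix.toEuclideanCLM (𝕜 := ℝ) A (EuclideanSpace.single b 1)) a)
  simp [Matrix.ofLp_toEuclideanCLM]

theorem matrixOpNorm_pow_le {N : ℕ} (A : Matrix (Fin N) (Fin N) ℝ) {k : ℕ} (hk : 1 ≤ k) :
    matrixOpNorm (A ^ k) ≤ matrixOpNorm A ^ k := by
  unfold matrixOpNorm
  rw [map_pow]
  exact norm_pow_le' _ hk

theorem matrixOpNorm_le_of_sum_sq_le {N : ℕ} (A : Matrix (Fin N) (Fin N) ℝ) {r : ℝ} (hr : 0 ≤ r)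
    (h : ∀ v : Fin N → ℝ, ∑ i, (∑ j, A i j * v j) ^ 2 ≤ r ^ 2 * ∑ j, v j ^ 2) :
    matrixOpNorm A ≤ r := by
  refine ContinuousLinearMap.opNorm_le_bound _ hr fun v => ?_
  refine (sq_le_sq₀ (norm_nonneg _) (by positivity)).1 ?_
  rw [mul_pow, EuclideanSpace.real_norm_sq_eq, EuclideanSpace.real_norm_sq_eq]
  simpa [Matrix.ofLp_toEuclideanCLM, Matrix.mulVec, dotProduct] using h v

/-- **(Lemma 4.2, (4.14)):** for a symmetric doubly stochastic matrix `S` with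
`C_inf ≤ N S_{ij} ≤ C_sup`, setting `T := S − Π`, there is a constant `c₀ ∈ [C_inf, 1]` with
`max_{a,b} |(T^k)_{ab}| ≤ ‖T^k‖ ≤ (1 − c₀)^k` for all `k ≥ 1`. -/
theorem op_norm_of_T_pow_decay
    (N : ℕ) (hN : 1 ≤ N) (Cinf Csup : ℝ) (hCinf : 0 < Cinf) (hCs : Cinf ≤ Csup)
    (S : Matrix (Fin N) (Fin N) ℝ) (hsymm : S.IsSymm)
    (hsum : ∀ j, (∑ i, S i j) = 1)
    (hlb : ∀ i j, Cinf ≤ (N : ℝ) * S i j) (hub : ∀ i j, (N : ℝ) * S i j ≤ Csup)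
    (Pi : Matrix (Fin N) (Fin N) ℝ) (hPi : ∀ a b, Pi a b = 1 / N)
    (T : Matrix (Fin N) (Fin N) ℝ) (hT : T = S - Pi) :
    ∃ c₀ : ℝ, Cinf ≤ c₀ ∧ c₀ ≤ 1 ∧ ∀ k : ℕ, 1 ≤ k →
      (∀ a b : Fin N, |(T ^ k) a b| ≤ matrixOpNorm (T ^ k)) ∧
      matrixOpNorm (T ^ k) ≤ (1 - c₀) ^ k := by
  have hN0 : (0 : ℝ) < N := by exact_mod_cast hN
  have hrow (i : Fin N) : ∑ j, S i j = 1 := by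
    rw [← hsum i]
    exact Finset.sum_congr rfl fun j _ => hsymm.apply j i
  have hC1 : Cinf ≤ 1 := by
    have h : ∑ _i : Fin N, Cinf ≤ ∑ i, (N : ℝ) * S i ⟨0, hN⟩ :=
      Finset.sum_le_sum fun i _ => hlb i _
    rw [← Finset.mul_sum, hsum] at h
    simp only [Finset.sum_const, Finset.card_univ, Fintype.card_fin, nsmul_eq_mul] at h
    exact le_of_mul_le_mul_left h hN0
  have hTnorm : matrixOpNorm T ≤ 1 - Cinf := by
    refine matrixOpNorm_le_of_sum_sq_le T (sub_nonneg.2 hC1) fun v => ?_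
    let R : Matrix (Fin N) (Fin N) ℝ := fun i j => S i j - Cinf / N
    have hconst : ∑ _i : Fin N, Cinf / N = Cinf := by
      simp only [Finset.sum_const, Finset.card_univ, Fintype.card_fin, nsmul_eq_mul]
      field_simp
    have hRrow (i : Fin N) : ∑ j, R i j = 1 - Cinf := by
      simp only [R, Finset.sum_sub_distrib, hrow, hconst]
    have hRcol (j : Fin N) : ∑ i, R i j = 1 - Cinf := by
      simp only [R, Finset.sum_sub_distrib, hsum, hconst]
    have hR0 (i j : Fin N) : 0 ≤ R i j :=
      sub_nonneg.2 ((div_le_iff₀' hN0).2 (hlb i j))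
    set m := (∑ j, v j) / (N : ℝ) with hm
    have hTR (i : Fin N) : ∑ j, T i j * v j = ∑ j, R i j * (v j - m) := by
      simp only [mul_sub, Finset.sum_sub_distrib, ← Finset.sum_mul, hRrow]
      simp only [R, hT, Matrix.sub_apply, hPi, sub_mul, Finset.sum_sub_distrib, ← Finset.mul_sum, hm]
      ring
    simp_rw [hTR]
    refine (sum_sq_mulVec_le_of_sum_eq R _ hR0 hRrow hRcol _).trans ?_
    refine mul_le_mul_of_nonneg_left ?_ (sq_nonneg _)
    simpa [hm] using sum_sq_sub_mean_le v
  refine ⟨Cinf, le_rfl, hC1, fun k hk => ⟨abs_apply_le_matrixOpNorm _, ?_⟩⟩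
  exact (matrixOpNorm_pow_le T hk).trans (pow_le_pow_left₀ (norm_nonneg _) hTnorm k)
end

section
/- Let N ≥ 1, let C_inf > 0, and let S be an N×N real symmetric matrix with nonnegative entries such that Σ_{i=1}^N S_{ij} = 1 for every j and N·S_{ij} ≥ C_inf for all i,j. Then: (i) 1 is an eigenvalue of S, and its eigenspace is one-dimensional, spanned by the all-ones vector; (ii) every eigenvalue λ of S with λ ≠ 1 satisfies |λ| ≤ 1 − C_inf (in particular the spectrum of S is contained in [−1 + C_inf, 1 − C_inf] ∪ {1}). -/
/-- An eigenvector with zero coordinate sum of a matrix with row sums `1` and entries at least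
`C / N` belongs to an eigenvalue of absolute value at most `1 - C`. -/
theorem abs_le_one_sub_of_mulVec_eq_smul_of_sum_eq_zero {N : ℕ} {C : ℝ}
    {S : Matrix (Fin N) (Fin N) ℝ} (hrow : ∀ i, ∑ j, S i j = 1)
    (hlb : ∀ i j, C ≤ (N : ℝ) * S i j) {lam : ℝ} {w : Fin N → ℝ} (hw : w ≠ 0)
    (hw_sum : ∑ j, w j = 0) (hSw : S.mulVec w = lam • w) : |lam| ≤ 1 - C := by
  obtain ⟨k, hk⟩ := Function.ne_iff.mp hw
  have hN : (0 : ℝ) < N := by exact_mod_cast k.pos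
  obtain ⟨i, -, hi⟩ := Finset.exists_max_image Finset.univ (fun j => |w j|) ⟨k, Finset.mem_univ k⟩
  have hpos : 0 < |w i| := (abs_pos.mpr hk).trans_le (hi k (Finset.mem_univ k))
  have hcoef (j : Fin N) : 0 ≤ S i j - C / N := by
    rw [sub_nonneg, div_le_iff₀' hN]
    exact hlb i j
  have heq : lam * w i = ∑ j, (S i j - C / N) * w j := by
    have h := congrFun hSw i
    simp only [Matrix.mulVec, dotProduct, Pi.smul_apply, smul_eq_mul] at h
    simp only [sub_mul, Finset.sum_sub_distrib, ← Finset.mul_sum, hw_sum, mul_zero, sub_zero, h]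
  refine le_of_mul_le_mul_right ?_ hpos
  calc |lam| * |w i| = |∑ j, (S i j - C / N) * w j| := by rw [← abs_mul, heq]
    _ ≤ ∑ j, |(S i j - C / N) * w j| := Finset.abs_sum_le_sum_abs _ _
    _ ≤ ∑ j, (S i j - C / N) * |w i| := by
      refine Finset.sum_le_sum fun j hj => ?_
      rw [abs_mul, abs_of_nonneg (hcoef j)]
      exact mul_le_mul_of_nonneg_left (hi j hj) (hcoef j)
    _ = (1 - C) * |w i| := by
      rw [← Finset.sum_mul, Finset.sum_sub_distrib, hrow]
      simp [mul_div_cancel₀ _ hN.ne']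

/-- **(Spectral gap (2.7)):** for a symmetric doubly stochastic matrix `S` with entries bounded
below by `C_inf/N`, the eigenvalue `1` is simple with eigenspace spanned by the all-ones vector,
and every other eigenvalue `λ` satisfies `|λ| ≤ 1 − C_inf`. -/
theorem spectral_gap_of_doubly_stochastic
    (N : ℕ) (hN : 1 ≤ N) (Cinf : ℝ) (hCinf : 0 < Cinf)
    (S : Matrix (Fin N) (Fin N) ℝ) (hsymm : S.IsSymm)
    (hnonneg : ∀ i j, 0 ≤ S i j) (hsum : ∀ j, (∑ i, S i j) = 1)
    (hlb : ∀ i j, Cinf ≤ (N : ℝ) * S i j) :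
    (Module.End.HasEigenvalue (Matrix.mulVecLin S) 1 ∧
      Module.End.eigenspace (Matrix.mulVecLin S) 1 =
        Submodule.span ℝ {fun _ => (1 : ℝ)}) ∧
    (∀ lam : ℝ, Module.End.HasEigenvalue (Matrix.mulVecLin S) lam → lam ≠ 1 →
      |lam| ≤ 1 - Cinf) := by
  have hrow (i : Fin N) : ∑ j, S i j = 1 := by
    simpa only [hsymm.apply] using hsum i
  have hN0 : (N : ℝ) ≠ 0 := by exact_mod_cast Nat.one_le_iff_ne_zero.mp hN
  have hone : S.mulVec (fun _ => (1 : ℝ)) = fun _ => 1 := by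
    ext i
    simp [Matrix.mulVec, dotProduct, hrow]
  have hone_mem :
      (fun _ => (1 : ℝ)) ∈ Module.End.eigenspace (Matrix.mulVecLin S) 1 := by
    simp [hone]
  refine ⟨⟨?_, ?_⟩, ?_⟩
  · refine Module.End.hasEigenvalue_of_hasEigenvector ⟨hone_mem, fun h => ?_⟩
    exact one_ne_zero (congrFun h ⟨0, hN⟩)
  · refine le_antisymm (fun v hv => ?_) ?_
    · rw [Module.End.mem_eigenspace_iff, Matrix.mulVecLin_apply, one_smul] at hv
      set m : ℝ := (∑ j, v j) / N with hm
      have hw : v - m • (fun _ => (1 : ℝ)) = 0 := by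
        by_contra hne
        have h := abs_le_one_sub_of_mulVec_eq_smul_of_sum_eq_zero (lam := 1) hrow hlb hne
          (by simp [hm, mul_div_cancel₀ _ hN0])
          (by rw [Matrix.mulVec_sub, Matrix.mulVec_smul, hone, hv, one_smul])
        rw [abs_one] at h
        linarith
      exact Submodule.mem_span_singleton.mpr ⟨m, (sub_eq_zero.mp hw).symm⟩
    · rwa [Submodule.span_singleton_le_iff_mem]
  · intro lam hlam hne
    obtain ⟨v, hv, hv0⟩ := hlam.exists_hasEigenvector
    rw [Module.End.mem_eigenspace_iff, Matrix.mulVecLin_apply] at hv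
    refine abs_le_one_sub_of_mulVec_eq_smul_of_sum_eq_zero hrow hlb hv0 ?_ hv
    have h : ∑ j, v j = lam * ∑ j, v j := by
      calc ∑ j, v j = ∑ i, S.mulVec v i := by
            simp only [Matrix.mulVec, dotProduct]
            rw [Finset.sum_comm]
            simp only [← Finset.sum_mul, hsum, one_mul]
        _ = lam * ∑ j, v j := by simp [hv, Finset.mul_sum]
    by_contra hs
    exact hne (mul_right_cancel₀ hs (by rw [one_mul, ← h]))
end

section
/- There exist constants c > 0 and C > 0 such that for every z = E + iη ∈ ℂ with |E| ≤ 5 and 0 < η ≤ 10 the following holds, where m_sc(z) is the unique m ∈ ℂ with Im m > 0 satisfying m² + z·m + 1 = 0, and κ := min(|E − 2|, |E + 2|): if |E| ≤ 2 then c·√(κ + η) ≤ Im m_sc(z) ≤ C·√(κ + η), and if |E| > 2 then c·η/√(κ + η) ≤ Im m_sc(z) ≤ C·η/√(κ + η). -/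
/-- The modulus and the components of a root of `m² + zm + 1` in the upper half-plane, where
`z = E + iη`. -/
theorem im_msc_components {E η : ℝ} (hη : 0 < η) {m : ℂ} (hm : 0 < m.im)
    (h : m ^ 2 + ((E : ℂ) + (η : ℂ) * Complex.I) * m + 1 = 0) :
    ∃ q : ℝ, 0 < q ∧ q < 1 ∧ m.re ^ 2 + m.im ^ 2 = q ∧ m.im * (1 - q) = η * q ∧
      m.re * (1 + q) = -(E * q) := by
  have hR := congrArg Complex.re h
  have hI := congrArg Complex.im h
  simp [pow_two] at hR hI
  have hq : 0 < m.re ^ 2 + m.im ^ 2 := by positivity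
  have him : m.im * (1 - (m.re ^ 2 + m.im ^ 2)) = η * (m.re ^ 2 + m.im ^ 2) := by
    linear_combination m.im * hR - m.re * hI
  refine ⟨_, hq, ?_, rfl, him, ?_⟩
  · have : 0 < m.im * (1 - (m.re ^ 2 + m.im ^ 2)) := him ▸ mul_pos hη hq
    linarith [pos_of_mul_pos_right this hm.le]
  · linear_combination m.re * hR + m.im * hI

/-- The square of `Im m` in terms of `q = |m|²` and `p = ((1 - q) / (1 + q))²`. -/
theorem im_msc_sq_eq {E η : ℝ} (hE : |E| ≤ 5) (hη : 0 < η) (hη' : η ≤ 10) {m : ℂ} (hm : 0 < m.im)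
    (h : m ^ 2 + ((E : ℂ) + (η : ℂ) * Complex.I) * m + 1 = 0) :
    ∃ q p : ℝ, 1 / 425 ≤ q ∧ q < 1 ∧ (1 - q) ^ 2 / 4 ≤ p ∧ p ≤ (1 - q) ^ 2 ∧
      m.im * (1 - q) = η * q ∧ m.im ^ 2 = q * (1 - |E| ^ 2 / 4 * (1 - p)) := by
  obtain ⟨q, hq, hq1, hsq, him, hre⟩ := im_msc_components hη hm h
  refine ⟨q, (1 - q) ^ 2 / (1 + q) ^ 2, ?_, hq1, ?_, ?_, him, ?_⟩
  · by_contra! hlt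
    have hy : m.im ≤ 20 * q := by nlinarith
    have hx : m.re ^ 2 ≤ 25 * q ^ 2 := by
      have h1 : (m.re * (1 + q)) ^ 2 = E ^ 2 * q ^ 2 := by rw [hre]; ring
      have h2 : E ^ 2 ≤ 25 := by nlinarith [abs_le.1 hE]
      nlinarith [mul_nonneg (sq_nonneg m.re) hq.le, mul_nonneg (sq_nonneg m.re) (sq_nonneg q),
        mul_le_mul_of_nonneg_right h2 (sq_nonneg q)]
    nlinarith
  · exact div_le_div_of_nonneg_left (sq_nonneg _) (by positivity) (by nlinarith)
  · exact div_le_self (sq_nonneg _) (by nlinarith)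
  · have hx : m.re = -(E * q) / (1 + q) := by field_simp; linarith
    have hy : m.im ^ 2 = q - m.re ^ 2 := by linarith
    rw [hy, hx, sq_abs]
    field_simp
    ring

theorem min_abs_sub_two_abs_add_two (E : ℝ) : min |E - 2| |E + 2| = |(|E| - 2)| := by
  rcases le_total 0 E with h | h
  · rw [abs_of_nonneg h, min_eq_left]
    exact abs_le_abs (by linarith) (by linarith)
  · rw [abs_of_nonpos h, min_eq_right, ← abs_neg (E + 2)]
    · congr 1; ring
    · rw [← abs_neg (E - 2)]
      exact abs_le_abs (by linarith) (by linarith)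

/-- Bulk estimate for `y = Im m`, with `e = |E| ≤ 2`. -/
theorem im_msc_bulk {e η q p y : ℝ} (he : 0 ≤ e) (he2 : e ≤ 2) (hη : 0 < η) (hη' : η ≤ 10)
    (hq : 1 / 425 ≤ q) (hq1 : q < 1) (hp : (1 - q) ^ 2 / 4 ≤ p) (hp' : p ≤ (1 - q) ^ 2)
    (hy : y * (1 - q) = η * q) (hy2 : y ^ 2 = q * (1 - e ^ 2 / 4 * (1 - p))) :
    (1 / 1000) ^ 2 * (2 - e + η) ≤ y ^ 2 ∧ y ^ 2 ≤ 1000 ^ 2 * (2 - e + η) := by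
  obtain ⟨t, ht⟩ : ∃ t, t = 1 - e ^ 2 / 4 * (1 - p) := ⟨_, rfl⟩
  rw [← ht] at hy2
  have hp0 : 0 ≤ p := by nlinarith [sq_nonneg (1 - q)]
  have hp1 : p ≤ 1 := by nlinarith
  have htκ : (2 - e) / 2 ≤ t := by nlinarith [mul_nonneg (sq_nonneg e) hp0]
  have ht0 : 0 ≤ t := by linarith
  have htd : t * (1 - q) ^ 2 = η ^ 2 * q := by
    have : q * (t * (1 - q) ^ 2) = q * (η ^ 2 * q) := by
      linear_combination (y * (1 - q) + η * q) * hy - (1 - q) ^ 2 * hy2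
    exact mul_left_cancel₀ (by linarith) this
  have hyle : y ^ 2 ≤ t := by nlinarith
  have hyge : t / 425 ≤ y ^ 2 := by nlinarith
  rcases le_total e 1 with h1 | h1
  · have : t ≤ 1 := by nlinarith [mul_nonneg (sq_nonneg e) (sub_nonneg.2 hp1)]
    constructor <;> linarith
  · have htp : p / 4 ≤ t := by
      nlinarith [mul_nonneg (sub_nonneg.2 hp1) (by nlinarith : (0 : ℝ) ≤ 4 - e ^ 2),
        mul_nonneg hp0 (by nlinarith : (0 : ℝ) ≤ e ^ 2 - 1)]
    have htd' : (1 - q) ^ 2 ≤ 16 * t := by linarith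
    have hlow : η / 100 ≤ t := by
      refine le_of_sq_le_sq ?_ ht0
      nlinarith [mul_le_mul_of_nonneg_left htd' ht0, mul_le_mul_of_nonneg_left hq (sq_nonneg η)]
    have hup : (1 - q) ^ 2 ≤ 4 * η := by
      refine le_of_sq_le_sq ?_ (by positivity)
      nlinarith [mul_le_mul_of_nonneg_right htd' (sq_nonneg (1 - q)), sq_nonneg η]
    have : t ≤ 2 - e + p := by nlinarith [mul_nonneg hp0 (by nlinarith : (0 : ℝ) ≤ 4 - e ^ 2)]
    constructor <;> linarith

/-- Estimate for `1 - q = 1 - |m|²` outside the spectrum, with `e = |E| > 2`. -/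
theorem one_sub_normSq_msc_outside {e η q p y : ℝ} (he : 2 < e) (he5 : e ≤ 5) (hη : 0 < η)
    (hq : 1 / 425 ≤ q) (hq1 : q < 1) (hp : (1 - q) ^ 2 / 4 ≤ p) (hp' : p ≤ (1 - q) ^ 2)
    (hy : y * (1 - q) = η * q) (hy2 : y ^ 2 = q * (1 - e ^ 2 / 4 * (1 - p))) :
    e - 2 + η ≤ 100 * (1 - q) ^ 2 ∧ (1 - q) ^ 2 ≤ 16 * (e - 2 + η) := by
  obtain ⟨D, hD⟩ : ∃ D, D = (1 - q) ^ 2 := ⟨_, rfl⟩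
  have hDpos : 0 < D := by rw [hD]; exact pow_pos (by linarith) 2
  have hp0 : 0 < p := by linarith
  have heq : (1 - e ^ 2 / 4 * (1 - p)) * D = η ^ 2 * q := by
    have : q * ((1 - e ^ 2 / 4 * (1 - p)) * D) = q * (η ^ 2 * q) := by
      rw [hD]
      linear_combination (y * (1 - q) + η * q) * hy - (1 - q) ^ 2 * hy2
    exact mul_left_cancel₀ (by linarith) this
  rw [← hD] at hp hp' ⊢
  obtain ⟨t, ht⟩ : ∃ t, t = 1 - e ^ 2 / 4 * (1 - p) := ⟨_, rfl⟩
  rw [← ht] at heq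
  have ht0 : 0 < t := by
    have : 0 < t * D := by rw [heq]; exact mul_pos (by positivity) (by linarith)
    exact pos_of_mul_pos_left this hDpos.le
  have hpe : e ^ 2 / 4 * p ≤ 25 / 4 * D := by
    have : e ^ 2 ≤ 25 := by nlinarith
    nlinarith
  have hpe' : D / 4 ≤ e ^ 2 / 4 * p := by
    nlinarith [mul_nonneg hp0.le (by nlinarith : (0 : ℝ) ≤ e ^ 2 - 4)]
  have hK : e - 2 ≤ e ^ 2 / 4 - 1 := by nlinarith
  have hK' : e ^ 2 / 4 - 1 ≤ 7 / 4 * (e - 2) := by nlinarith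
  constructor
  · have : η ≤ 60 * D := by
      refine le_of_sq_le_sq ?_ (by positivity)
      nlinarith [mul_le_mul_of_nonneg_left hq (sq_nonneg η)]
    nlinarith
  · by_contra! hlt
    have h1 : D / 8 ≤ t := by nlinarith
    have h2 : 16 * η ≤ D := by linarith
    nlinarith [mul_le_mul_of_nonneg_right h1 hDpos.le, mul_pos hη hη]

/-- **Lemma 2.4 (quantitative behaviour of `Im m_sc`):** there are constants `c, C > 0` such that
for `z = E + iη` with `|E| ≤ 5`, `0 < η ≤ 10`, and `κ = min(|E−2|, |E+2|)`, the unique solution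
`m` of `m² + z m + 1 = 0` in the upper half-plane satisfies `Im m ∼ √(κ+η)` for `|E| ≤ 2` and
`Im m ∼ η/√(κ+η)` for `|E| > 2`. -/
theorem im_msc_asymptotics :
    ∃ c : ℝ, 0 < c ∧ ∃ C : ℝ, 0 < C ∧
      ∀ E η : ℝ, |E| ≤ 5 → 0 < η → η ≤ 10 →
      ∀ m : ℂ, 0 < m.im → m ^ 2 + ((E : ℂ) + (η : ℂ) * Complex.I) * m + 1 = 0 →
        (|E| ≤ 2 →
          c * Real.sqrt (min |E - 2| |E + 2| + η) ≤ m.im ∧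
          m.im ≤ C * Real.sqrt (min |E - 2| |E + 2| + η)) ∧
        (2 < |E| →
          c * (η / Real.sqrt (min |E - 2| |E + 2| + η)) ≤ m.im ∧
          m.im ≤ C * (η / Real.sqrt (min |E - 2| |E + 2| + η))) := by
  refine ⟨1 / 10000, by norm_num, 1000, by norm_num, fun E η hE hη hη' m hm h ↦ ?_⟩
  obtain ⟨q, p, hq, hq1, hp, hp', hy, hy2⟩ := im_msc_sq_eq hE hη hη' hm h
  rw [min_abs_sub_two_abs_add_two]
  refine ⟨fun h2 ↦ ?_, fun h2 ↦ ?_⟩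
  · obtain ⟨hl, hu⟩ := im_msc_bulk (abs_nonneg E) h2 hη hη' hq hq1 hp hp' hy hy2
    rw [abs_of_nonpos (by linarith), neg_sub]
    have hS : 0 ≤ 2 - |E| + η := by linarith
    have hs := Real.sq_sqrt hS
    constructor
    · refine le_of_sq_le_sq ?_ hm.le
      rw [mul_pow, hs]
      linarith
    · refine le_of_sq_le_sq ?_ (by positivity)
      rwa [mul_pow, hs]
  · obtain ⟨hl, hu⟩ := one_sub_normSq_msc_outside h2 hE hη hq hq1 hp hp' hy hy2
    rw [abs_of_pos (by linarith)]
    have hS : 0 < |E| - 2 + η := by linarith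
    have hs := Real.sq_sqrt hS.le
    have hs0 := Real.sqrt_pos.2 hS
    have hd : 0 < 1 - q := by linarith
    have hl' : √(|E| - 2 + η) ≤ 10 * (1 - q) := by
      refine le_of_sq_le_sq ?_ (by positivity)
      rw [hs, mul_pow]
      linarith
    have hu' : 1 - q ≤ 4 * √(|E| - 2 + η) := by
      refine le_of_sq_le_sq ?_ (by positivity)
      rw [mul_pow, hs]
      linarith
    have hy' : m.im = η * q / (1 - q) := by field_simp; exact hy
    rw [hy', ← mul_div_assoc, ← mul_div_assoc, div_le_div_iff₀ hs0 hd, div_le_div_iff₀ hd hs0]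
    constructor
    · have : 1 / 10000 * (1 - q) ≤ q * √(|E| - 2 + η) := by nlinarith
      nlinarith
    · have : q * √(|E| - 2 + η) ≤ 1000 * (1 - q) := by nlinarith
      nlinarith
end
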